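/- arXiv:2204.04101 — 6 statements merged into one kernel-verified Lean document; each statement's English description precedes it below -/
import Mathlib

section
/- If g, h ∈ ℚ̄[x] are polynomials of positive degree whose leading coefficients lie in ℤ̄^×, and f = g ∘ h has coefficients in ℤ, then the polynomials g(x + h(0)) and h(x) − h(0) both lie in ℤ̄[x]. -/
open Polynomial

lemma coeff_integral_of_roots (p : Polynomial ℂ) (hl : IsIntegral ℤ p.leadingCoeff)
    (hr : ∀ r, p.IsRoot r → IsIntegral ℤ r) (i : ℕ) : IsIntegral ℤ (p.coeff i) := by
  by_cases hp : p = 0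
  · simp [hp, isIntegral_zero]
  have hmem : p ∈ Polynomial.lifts (algebraMap (integralClosure ℤ ℂ) ℂ) := by
    rw [(IsAlgClosed.splits p).eq_prod_roots]
    refine mul_mem (Polynomial.C_mem_lifts (algebraMap (integralClosure ℤ ℂ) ℂ) ⟨_, hl⟩) ?_
    refine multiset_prod_mem _ ?_
    intro q hq
    obtain ⟨r, hr', rfl⟩ := Multiset.mem_map.1 hq
    have hint := hr r ((Polynomial.mem_roots hp).1 hr')
    rw [Polynomial.mem_lifts]
    exact ⟨X - C ⟨r, hint⟩, by simp [Polynomial.map_sub]⟩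
  obtain ⟨q, hq⟩ := (Polynomial.mem_lifts _).1 hmem
  rw [← hq, Polynomial.coeff_map]
  exact (q.coeff i).2

/-- If `g, h ∈ ℚ̄[x]` have positive degree and leading coefficients that are units in the ring of
algebraic integers, and `g ∘ h` has integer coefficients, then `g(x + h(0))` and `h(x) − h(0)`
have algebraic integer coefficients. Here polynomials over `ℚ̄` are realized as polynomials over
`ℂ` all of whose coefficients are algebraic over `ℚ`, and `ℤ̄` as the elements of `ℂ` integral
over `ℤ`. -/
theorem integrality_of_composition_factors
    (g h : Polynomial ℂ)
    (hgdeg : 0 < g.natDegree) (hhdeg : 0 < h.natDegree)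
    (hgalg : ∀ i, IsAlgebraic ℚ (g.coeff i)) (hhalg : ∀ i, IsAlgebraic ℚ (h.coeff i))
    (hglead : IsIntegral ℤ g.leadingCoeff ∧ ∃ u : ℂ, IsIntegral ℤ u ∧ g.leadingCoeff * u = 1)
    (hhlead : IsIntegral ℤ h.leadingCoeff ∧ ∃ u : ℂ, IsIntegral ℤ u ∧ h.leadingCoeff * u = 1)
    (F : Polynomial ℤ) (hF : g.comp h = F.map (Int.castRingHom ℂ)) :
    (∀ i, IsIntegral ℤ ((g.comp (X + C (h.eval 0))).coeff i)) ∧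
    (∀ i, IsIntegral ℤ ((h - C (h.eval 0)).coeff i)) := by
  obtain ⟨hgi, u, hu, hgu⟩ := hglead
  obtain ⟨hhi, v, hv, hhv⟩ := hhlead
  have hinj : Function.Injective (Int.castRingHom ℂ) := Int.cast_injective
  have hlead : ((F.leadingCoeff : ℤ) : ℂ) = g.leadingCoeff * h.leadingCoeff ^ g.natDegree := by
    have h1 := congrArg Polynomial.leadingCoeff hF
    rw [Polynomial.leadingCoeff_comp hhdeg.ne',
      Polynomial.leadingCoeff_map_of_injective hinj] at h1
    simpa using h1.symm
  have hroot : ∀ r : ℂ, g.eval (h.eval r) = 0 → IsIntegral ℤ r := by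
    intro r hr
    have h0 : aeval r F = 0 := by
      rw [← Polynomial.eval_comp, hF] at hr
      rwa [Polynomial.eval_map] at hr
    have h2 := (isIntegral_leadingCoeff_smul F r h0).mul (hu.mul (hv.pow g.natDegree))
    have h3 : (F.leadingCoeff • r) * (u * v ^ g.natDegree) = r := by
      rw [zsmul_eq_mul, hlead]
      calc _ = (g.leadingCoeff * u) * (h.leadingCoeff * v) ^ g.natDegree * r := by
            rw [mul_pow]; ring
        _ = r := by rw [hgu, hhv]; simp
    rwa [h3] at h2
  have key : ∀ c : ℂ, g.eval c = 0 → ∀ i, IsIntegral ℤ ((h - C c).coeff i) := by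
    intro c hc
    apply coeff_integral_of_roots
    · have : (h - C c).leadingCoeff = h.leadingCoeff := by
        rw [Polynomial.leadingCoeff, Polynomial.natDegree_sub_C, Polynomial.coeff_sub,
          Polynomial.coeff_C_of_ne_zero hhdeg.ne', sub_zero, Polynomial.leadingCoeff]
      rwa [this]
    · intro r hr
      apply hroot
      have : h.eval r = c := by
        simpa [Polynomial.IsRoot, sub_eq_zero] using hr
      rw [this, hc]
  constructor
  · apply coeff_integral_of_roots
    · rw [Polynomial.leadingCoeff_comp (by simp)]
      simpa using hgi
    · intro b hb
      have hb' : g.eval (b + h.eval 0) = 0 := by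
        simpa [Polynomial.IsRoot, Polynomial.eval_comp] using hb
      have h4 := (key _ hb' 0).neg
      simpa [Polynomial.coeff_zero_eq_eval_zero] using h4
  · intro i
    obtain ⟨c, hc⟩ := IsAlgClosed.exists_root g (by
      intro h0
      rw [Polynomial.natDegree_eq_of_degree_eq_some h0] at hgdeg
      exact lt_irrefl _ hgdeg)
    rcases Nat.eq_zero_or_pos i with rfl | hi
    · simp [Polynomial.coeff_zero_eq_eval_zero, isIntegral_zero]
    · have h5 := key c hc i
      rw [Polynomial.coeff_sub, Polynomial.coeff_C_of_ne_zero hi.ne'] at h5 ⊢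
      exact h5
end

section
/- Suppose f ∈ ℚ̄[x] is a polynomial of degree greater than 1 such that for some n ≥ 1 the n-fold iterate f^n = f ∘ ⋯ ∘ f is a monic polynomial with coefficients in ℤ̄. Then f itself has coefficients in ℤ̄. -/
open Polynomial

noncomputable section

/-- The `k`-fold compositional iterate `f^k = f ∘ ⋯ ∘ f` of a polynomial, with `f^0 = X`. -/
def polyIter (f : Polynomial ℂ) (k : ℕ) : Polynomial ℂ := (fun p => p.comp f)^[k] X

theorem lt_degree_of_one_lt {p : Polynomial ℂ} (h : 1 < p.natDegree) : 1 < p.degree := by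
  rw [degree_eq_natDegree (by rintro rfl; simp at h)]
  exact_mod_cast h

theorem polyIter_succ (f : Polynomial ℂ) (k : ℕ) :
    polyIter f (k + 1) = (polyIter f k).comp f := by
  simp only [polyIter, Function.iterate_succ_apply']

theorem polyIter_natDegree (f : Polynomial ℂ) (k : ℕ) :
    (polyIter f k).natDegree = f.natDegree ^ k := by
  induction k with
  | zero => simp [polyIter]
  | succ k ih => rw [polyIter_succ, natDegree_comp, ih, pow_succ]

theorem polyIter_lc (f : Polynomial ℂ) (hf : 1 < f.natDegree) (k : ℕ) :
    ∃ m, k ≤ m ∧ (polyIter f k).leadingCoeff = f.leadingCoeff ^ m := by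
  induction k with
  | zero => exact ⟨0, le_rfl, by simp [polyIter]⟩
  | succ k ih =>
    obtain ⟨m, hm, h⟩ := ih
    refine ⟨m + f.natDegree ^ k, ?_, ?_⟩
    · have : 0 < f.natDegree ^ k := by positivity
      omega
    · rw [polyIter_succ, leadingCoeff_comp (by omega), h, polyIter_natDegree, pow_add]

theorem polyIter_fixed (f : Polynomial ℂ) (x : ℂ) (hx : f.eval x = x) (k : ℕ) :
    (polyIter f k).eval x = x := by
  induction k with
  | zero => simp [polyIter]
  | succ k ih => rw [polyIter_succ, eval_comp, hx, ih]

theorem mem_lifts_of_integral (p : Polynomial ℂ) :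
    p ∈ lifts (algebraMap (integralClosure ℤ ℂ) ℂ) ↔ ∀ i, IsIntegral ℤ (p.coeff i) := by
  rw [lifts_iff_coeff_lifts]
  refine forall_congr' fun i => ?_
  constructor
  · rintro ⟨y, hy⟩
    rw [← hy]; exact y.2
  · intro h
    exact ⟨⟨_, h⟩, rfl⟩

/-- If `f ∈ ℚ̄[x]` has degree `> 1` and some iterate `f^n` (with `n ≥ 1`) is a monic polynomial
with algebraic integer coefficients, then `f` itself has algebraic integer coefficients.
Here `ℚ̄` is realized as the algebraic numbers inside `ℂ` and `ℤ̄` as the elements of `ℂ`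
integral over `ℤ`. -/
theorem integrality_of_root_of_iterate
    (f : Polynomial ℂ) (halg : ∀ i, IsAlgebraic ℚ (f.coeff i))
    (hdeg : 1 < f.natDegree) (n : ℕ) (hn : 1 ≤ n)
    (hmonic : (polyIter f n).Monic)
    (hint : ∀ i, IsIntegral ℤ ((polyIter f n).coeff i)) :
    ∀ i, IsIntegral ℤ (f.coeff i) := by
  have ha : IsIntegral ℤ f.leadingCoeff := by
    obtain ⟨m, hm, h⟩ := polyIter_lc f hdeg n
    rw [hmonic.leadingCoeff] at h
    refine IsIntegral.of_pow (n := m) (by omega) ?_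
    rw [← h]; exact isIntegral_one
  -- fixed points of `f` are integral
  have hfix : ∀ x : ℂ, f.eval x = x → IsIntegral ℤ x := by
    intro x hx
    have hdg : 1 < (polyIter f n).natDegree := by
      rw [polyIter_natDegree]; exact Nat.one_lt_pow (by omega) hdeg
    have hm : (polyIter f n - X).Monic := by
      apply hmonic.sub_of_left
      rw [degree_X]
      exact lt_degree_of_one_lt hdg
    have hl : polyIter f n - X ∈ lifts (algebraMap (integralClosure ℤ ℂ) ℂ) := by
      rw [mem_lifts_of_integral]
      intro i
      rw [coeff_sub]
      refine (hint i).sub ?_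
      rw [coeff_X]
      split_ifs
      · exact isIntegral_one
      · exact isIntegral_zero
    obtain ⟨q, hq, -, hqm⟩ := lifts_and_degree_eq_and_monic hl hm
    refine isIntegral_trans (A := integralClosure ℤ ℂ) x ⟨q, hqm, ?_⟩
    rw [← eval_map, hq, eval_sub, eval_X, polyIter_fixed f x hx, sub_self]
  have hX : (X : ℂ[X]).degree < f.degree := by
    rw [degree_X]
    exact lt_degree_of_one_lt hdeg
  have hlc : (f - X).leadingCoeff = f.leadingCoeff := leadingCoeff_sub_of_degree_lt hX
  have h0 : f - X ≠ 0 := by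
    intro h
    rw [sub_eq_zero.1 h] at hX
    exact lt_irrefl _ hX
  have hprod := (IsAlgClosed.splits (f - X)).eq_prod_roots
  rw [← mem_lifts_of_integral]
  have hf : f = (f - X) + X := by ring
  rw [hf]
  refine add_mem ?_ (X_mem_lifts _)
  rw [hprod, hlc]
  refine mul_mem (C_mem_lifts (algebraMap (integralClosure ℤ ℂ) ℂ) ⟨_, ha⟩) ?_
  refine multiset_prod_mem _ fun p hp => ?_
  obtain ⟨x, hx, rfl⟩ := Multiset.mem_map.1 hp
  have hx' : IsIntegral ℤ x := by
    apply hfix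
    have := (mem_roots h0).1 hx
    simpa [IsRoot, sub_eq_zero] using this
  have e : X - C x = X + C (-x) := by simp [sub_eq_add_neg]
  rw [e]
  exact add_mem (X_mem_lifts _) (C_mem_lifts (algebraMap (integralClosure ℤ ℂ) ℂ) ⟨_, hx'.neg⟩)
end
end

section
/- Let f ∈ ℤ̄[x] be a monic polynomial of degree greater than 1 that is not affine conjugate over ℂ to a power function z^d or to plus or minus a Chebyshev polynomial. If g ∈ ℚ̄[x] has degree greater than 1 and commutes under composition with some iterate f^k of f, then g ∈ ℤ̄[x]. -/
open Polynomial

noncomputable section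

/-- `g` is affine conjugate to `f` over `ℂ`: `g = L⁻¹ ∘ f ∘ L` for some `L(z) = az + b`, `a ≠ 0`. -/
def AffConj (f g : Polynomial ℂ) : Prop :=
  ∃ a b : ℂ, a ≠ 0 ∧ g = C a⁻¹ * (f.comp (C a * X + C b) - C b)

/-- `f` is exceptional: affine conjugate over `ℂ` to a power function `z^d` or to plus or minus
a Chebyshev polynomial `T_d` (normalized so that `T_d(z + z⁻¹) = z^d + z^{-d}`, i.e. the Dickson
polynomial `D_d(x, 1)`). -/
def IsExceptional (f : Polynomial ℂ) : Prop :=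
  ∃ d : ℕ, AffConj f (X ^ d) ∨ AffConj f (Polynomial.dickson 1 1 d) ∨
    AffConj f (-Polynomial.dickson 1 1 d)

/-- Over a valuation ring `V` of `K`: a polynomial over `K` commuting with a monic polynomial over
`V` of degree at least two has coefficients in `V`. -/
theorem coeff_mem_of_comm {K : Type*} [Field K] (V : ValuationSubring K) (F : Polynomial V)
    (hF : F.Monic) (hdeg : 1 < F.natDegree) (g : Polynomial K)
    (hcomm : g.comp (F.map (algebraMap V K)) = (F.map (algebraMap V K)).comp g) (i : ℕ) :
    g.coeff i ∈ V := by
  by_contra hi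
  have hne : g.support.Nonempty := by
    refine ⟨i, ?_⟩
    rw [mem_support_iff]
    intro h
    exact hi (h ▸ V.zero_mem)
  obtain ⟨j, hj, hmax⟩ := g.support.exists_max_image (fun n => V.valuation (g.coeff n)) hne
  have hmax' : ∀ n, V.valuation (g.coeff n) ≤ V.valuation (g.coeff j) := by
    intro n
    by_cases hn : n ∈ g.support
    · exact hmax n hn
    · rw [notMem_support_iff.mp hn]; simp
  set c := g.coeff j with hc
  have hc0 : c ≠ 0 := mem_support_iff.mp hj
  have hvc0 : V.valuation c ≠ 0 := by simpa using hc0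
  have hc1 : 1 < V.valuation c := by
    refine lt_of_lt_of_le ?_ (hmax' i)
    rw [← not_le, V.valuation_le_one_iff]
    exact hi
  have hcinv : V.valuation c⁻¹ < 1 := by
    rw [map_inv₀]
    exact inv_lt_one_of_one_lt₀ hc1
  let t : V := ⟨c⁻¹, (V.valuation_le_one_iff _).mp hcinv.le⟩
  have ht : IsLocalRing.residue V t = 0 := by
    rw [IsLocalRing.residue_eq_zero_iff]
    exact (V.valuation_lt_one_iff t).mpr hcinv
  have hlift : C c⁻¹ * g ∈ lifts (algebraMap V K) := by
    rw [lifts_iff_coeff_lifts]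
    intro n
    refine ⟨⟨c⁻¹ * g.coeff n, (V.valuation_le_one_iff _).mp ?_⟩, ?_⟩
    · rw [map_mul, map_inv₀]
      calc _ ≤ (V.valuation c)⁻¹ * V.valuation c := mul_le_mul_right (hmax' n) _
        _ = 1 := inv_mul_cancel₀ hvc0
    · rw [coeff_C_mul]; rfl
  obtain ⟨h, hh⟩ := hlift
  have hh' : h.map (algebraMap V K) = C c⁻¹ * g := hh
  have hinj : Function.Injective (algebraMap V K) := Subtype.val_injective
  have hhj : h.coeff j = 1 := by
    apply hinj
    rw [← coeff_map, hh', coeff_C_mul, ← hc, inv_mul_cancel₀ hc0, map_one]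
  have key : (scaleRoots F t).comp h = C (t ^ (F.natDegree - 1)) * h.comp F := by
    apply map_injective _ hinj
    have ht' : algebraMap V K t = c⁻¹ := rfl
    have h1 : ((scaleRoots F t).map (algebraMap V K)) = scaleRoots (F.map (algebraMap V K)) c⁻¹ :=
      by rw [map_scaleRoots _ _ _ (by simp [hF.leadingCoeff]), ht']
    rw [Polynomial.map_comp, h1, hh', Polynomial.map_mul, Polynomial.map_comp, hh', map_C, map_pow,
      ht', mul_comp, C_comp, hcomm]
    have := scaleRoots_eval₂_mul (p := F.map (algebraMap V K)) C g c⁻¹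
    rw [comp, this, hF.natDegree_map, comp, ← mul_assoc]
    congr 1
    rw [← C_pow, ← C_mul, ← pow_succ]
    congr 3
    omega
  have key2 := congrArg (Polynomial.map (IsLocalRing.residue V)) key
  rw [Polynomial.map_comp, Polynomial.map_mul, map_C, map_pow, ht, zero_pow (by omega), C_0,
    zero_mul, map_scaleRoots _ _ _ (by simp [hF.leadingCoeff]), ht,
    scaleRoots_zero, (hF.map _).leadingCoeff, one_smul, X_pow_comp] at key2
  have h0 := eq_zero_of_pow_eq_zero key2
  have := congrArg (fun p => coeff p j) h0
  simp [hhj] at this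

theorem polyIter_lift (V : ValuationSubring ℂ) (f : Polynomial V) (hf : f.Monic)
    (hd : 1 < f.natDegree) (k : ℕ) : ∃ F : Polynomial V, F.Monic ∧ (1 ≤ k → 1 < F.natDegree) ∧
      0 < F.natDegree ∧
      F.map (algebraMap V ℂ) = polyIter (f.map (algebraMap V ℂ)) k := by
  induction k with
  | zero => exact ⟨X, monic_X, by simp, by simp, by simp [polyIter]⟩
  | succ k ih =>
    obtain ⟨F, hF, -, h0, he⟩ := ih
    have hdeg : 1 < (F.comp f).natDegree := by
      rw [natDegree_comp]; nlinarith
    refine ⟨F.comp f, hF.comp hf (by omega), fun _ => hdeg, by omega, ?_⟩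
    rw [Polynomial.map_comp, he]
    simp [polyIter, Function.iterate_succ_apply']

/-- If `f ∈ ℤ̄[x]` is monic of degree `> 1`, not affine conjugate over `ℂ` to a power function or
to plus or minus a Chebyshev polynomial, and `g ∈ ℚ̄[x]` of degree `> 1` commutes with some
iterate `f^k` of `f`, then `g ∈ ℤ̄[x]`. -/
theorem integrality_of_commuting_polynomial
    (f : Polynomial ℂ) (hmonic : f.Monic) (hfdeg : 1 < f.natDegree)
    (hfint : ∀ i, IsIntegral ℤ (f.coeff i))
    (hexc : ¬ IsExceptional f)
    (g : Polynomial ℂ) (hgdeg : 1 < g.natDegree)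
    (hgalg : ∀ i, IsAlgebraic ℚ (g.coeff i))
    (k : ℕ) (hk : 1 ≤ k)
    (hcomm : g.comp (polyIter f k) = (polyIter f k).comp g) :
    ∀ i, IsIntegral ℤ (g.coeff i) := by
  intro i
  by_contra hi
  have hi' : g.coeff i ∉ (integralClosure ℤ ℂ).toSubring := hi
  haveI : IsIntegrallyClosedIn (integralClosure ℤ ℂ).toSubring ℂ :=
    inferInstanceAs (IsIntegrallyClosedIn (integralClosure ℤ ℂ) ℂ)
  obtain ⟨V, hV, hgV⟩ := Subring.exists_le_valuationSubring_of_isIntegrallyClosedIn hi'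
  have hl : f ∈ lifts (algebraMap V ℂ) := by
    rw [lifts_iff_coeff_lifts]
    intro n
    exact ⟨⟨f.coeff n, hV (hfint n)⟩, rfl⟩
  obtain ⟨f₀, hf₀, hdeg₀, hmon₀⟩ := lifts_and_natDegree_eq_and_monic hl hmonic
  obtain ⟨F, hF, hFd, -, hFe⟩ := polyIter_lift V f₀ hmon₀ (by omega) k
  rw [hf₀] at hFe
  exact hgV (coeff_mem_of_comm V F hF (hFd hk) g (by rw [hFe]; exact hcomm) i)
end
end

section
/- If f ∈ ℤ̄[x] is a monic polynomial of degree greater than 1, and L ∈ ℚ̄[x] is a linear polynomial that commutes with f under composition (L ∘ f = f ∘ L), then L ∈ ℤ̄[x]. -/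
open Polynomial

theorem isIntegral_of_root_aux (p : Polynomial ℂ) (hp : p.Monic)
    (hint : ∀ i, IsIntegral ℤ (p.coeff i)) (b : ℂ) (hb : p.eval b = 0) : IsIntegral ℤ b := by
  have hl : p ∈ Polynomial.lifts (algebraMap (integralClosure ℤ ℂ) ℂ) := by
    rw [Polynomial.lifts_iff_coeff_lifts]
    intro i
    exact ⟨⟨p.coeff i, hint i⟩, rfl⟩
  obtain ⟨q, hq, -, hqm⟩ := Polynomial.lifts_and_natDegree_eq_and_monic hl hp
  have h : IsIntegral (integralClosure ℤ ℂ) b := ⟨q, hqm, by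
    rw [← Polynomial.eval_map, hq, hb]⟩
  exact isIntegral_trans b h

/-- If `f ∈ ℤ̄[x]` is monic of degree `> 1` and `L ∈ ℚ̄[x]` is a linear polynomial commuting with
`f` under composition, then `L ∈ ℤ̄[x]`. Here `ℚ̄` is realized as the algebraic numbers inside
`ℂ` and `ℤ̄` as the elements of `ℂ` integral over `ℤ`. -/
theorem integrality_of_commuting_linear
    (f : Polynomial ℂ) (hmonic : f.Monic) (hfdeg : 1 < f.natDegree)
    (hfint : ∀ i, IsIntegral ℤ (f.coeff i))
    (L : Polynomial ℂ) (hL : L.natDegree = 1)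
    (hLalg : ∀ i, IsAlgebraic ℚ (L.coeff i))
    (hcomm : L.comp f = f.comp L) :
    ∀ i, IsIntegral ℤ (L.coeff i) := by
  have hLe : L = C (L.coeff 1) * X + C (L.coeff 0) :=
    Polynomial.eq_X_add_C_of_natDegree_le_one hL.le
  have ha0 : L.coeff 1 ≠ 0 := by
    have : L.leadingCoeff ≠ 0 := by
      rw [Polynomial.leadingCoeff_ne_zero]
      rintro rfl
      simp at hL
    rwa [Polynomial.leadingCoeff, hL] at this
  have hlead : L.coeff 1 = L.coeff 1 ^ f.natDegree := by
    have h := congrArg Polynomial.leadingCoeff hcomm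
    rw [Polynomial.leadingCoeff_comp (by omega), Polynomial.leadingCoeff_comp (by omega),
      hmonic.leadingCoeff, one_pow, mul_one, one_mul, Polynomial.leadingCoeff, hL] at h
    exact h
  have ha : IsIntegral ℤ (L.coeff 1) := by
    have h1 : L.coeff 1 ^ (f.natDegree - 1) = 1 := by
      apply mul_right_cancel₀ ha0
      rw [← pow_succ, one_mul, Nat.sub_add_cancel (by omega)]
      exact hlead.symm
    exact IsIntegral.of_pow (n := f.natDegree - 1) (by omega) (h1 ▸ isIntegral_one)
  have hev : L.coeff 1 * f.coeff 0 + L.coeff 0 = f.eval (L.coeff 0) := by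
    have h := congrArg (Polynomial.eval 0) hcomm
    rw [Polynomial.eval_comp, Polynomial.eval_comp, ← Polynomial.coeff_zero_eq_eval_zero,
      ← Polynomial.coeff_zero_eq_eval_zero] at h
    rw [← h]
    conv_rhs => rw [hLe]
    simp
  have hb : IsIntegral ℤ (L.coeff 0) := by
    apply isIntegral_of_root_aux (f - (X + C (L.coeff 1 * f.coeff 0)))
    · apply hmonic.sub_of_left
      rw [Polynomial.degree_X_add_C, Polynomial.degree_eq_natDegree hmonic.ne_zero]
      exact_mod_cast hfdeg
    · intro i
      rw [Polynomial.coeff_sub, Polynomial.coeff_add, Polynomial.coeff_X, Polynomial.coeff_C]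
      refine (hfint i).sub (IsIntegral.add ?_ ?_)
      · split_ifs
        · exact isIntegral_one
        · exact isIntegral_zero
      · split_ifs
        · exact ha.mul (hfint 0)
        · exact isIntegral_zero
    · simp only [Polynomial.eval_sub, Polynomial.eval_add, Polynomial.eval_X, Polynomial.eval_C]
      rw [← hev]
      ring
  intro i
  match i with
  | 0 => exact hb
  | 1 => exact ha
  | k + 2 =>
    rw [Polynomial.coeff_eq_zero_of_natDegree_lt (by omega)]
    exact isIntegral_zero
end

section
/- If f ∈ ℚ̄[x] is a polynomial of degree greater than 1, then any polynomial g ∈ ℂ[x] that commutes with f under composition (g ∘ f = f ∘ g) has all of its coefficients algebraic over ℚ, i.e. g ∈ ℚ̄[x]. -/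
open Polynomial

/-- A complex polynomial with only one root `t` has derivative divisible by a high power. -/
theorem pow_dvd_derivative_aux (p : ℂ[X]) (t : ℂ) (h : ∀ x, p.eval x = 0 → x = t) :
    (X - C t) ^ (p.natDegree - 1) ∣ derivative p := by
  have hs : p.Splits := IsAlgClosed.splits p
  have hr : p.roots = Multiset.replicate p.natDegree t := by
    rw [Multiset.eq_replicate]
    refine ⟨hs.natDegree_eq_card_roots.symm, fun b hb => h b ?_⟩
    exact (mem_roots'.1 hb).2
  have hp : p = C p.leadingCoeff * (X - C t) ^ p.natDegree := by
    conv_lhs => rw [hs.eq_prod_roots, hr]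
    simp
  have hd : (X - C t) ^ p.natDegree ∣ p := ⟨C p.leadingCoeff, by rw [mul_comm]; exact hp⟩
  exact pow_sub_one_dvd_derivative_of_pow_dvd hd

/-- Preperiodic points of a polynomial. -/
def preperAux (f : ℂ[X]) : Set ℂ :=
  {x | ∃ m n, m < n ∧ (fun y => f.eval y)^[m] x = (fun y => f.eval y)^[n] x}

theorem preperAux_infinite (f : ℂ[X]) (hdeg : 1 < f.natDegree) : (preperAux f).Infinite := by
  intro hfin
  have hmap : ∀ x ∈ preperAux f, f.eval x ∈ preperAux f := by
    rintro x ⟨m, n, hmn, h⟩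
    refine ⟨m, n, hmn, ?_⟩
    have := congrArg (fun y => f.eval y) h
    rw [← Function.iterate_succ_apply, ← Function.iterate_succ_apply]
    rw [Function.iterate_succ_apply', Function.iterate_succ_apply']
    exact this
  have hback : ∀ x, f.eval x ∈ preperAux f → x ∈ preperAux f := by
    rintro x ⟨m, n, hmn, h⟩
    refine ⟨m + 1, n + 1, by omega, ?_⟩
    rw [Function.iterate_succ_apply, Function.iterate_succ_apply]
    exact h
  have hdegC : ∀ s : ℂ, (f - C s).natDegree = f.natDegree := fun s => natDegree_sub_C
  have hsurjOn : Set.SurjOn (fun y => f.eval y) (preperAux f) (preperAux f) := by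
    intro s hs
    obtain ⟨x, hx⟩ := IsAlgClosed.exists_root (f - C s) (by
      intro h0
      have := natDegree_eq_zero_iff_degree_le_zero.2 h0.le
      rw [hdegC] at this; omega)
    have hx' : f.eval x = s := by
      have : f.eval x - s = 0 := by simpa using hx
      exact sub_eq_zero.1 this
    exact ⟨x, hback x (by rw [hx']; exact hs), hx'⟩
  have hinj : Set.InjOn (fun y => f.eval y) (preperAux f) := by
    exact ((hfin.surjOn_iff_bijOn_of_mapsTo hmap).1 hsurjOn).injOn
  have hdvd : ∀ t ∈ preperAux f, (X - C t) ^ (f.natDegree - 1) ∣ derivative f := by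
    intro t ht
    have := pow_dvd_derivative_aux (f - C (f.eval t)) t (by
      intro x hx
      have hx' : f.eval x = f.eval t := by
        have : f.eval x - f.eval t = 0 := by simpa using hx
        exact sub_eq_zero.1 this
      exact hinj (hback x (by rw [hx']; exact hmap t ht)) ht hx')
    rw [hdegC] at this
    simpa using this
  have hd0 : derivative f ≠ 0 := by
    intro h
    have := derivative_eq_zero.1 h
    omega
  have hsub : ∀ t ∈ preperAux f, ∀ u ∈ preperAux f, t = u := by
    intro t ht u hu
    by_contra hne
    have hc : IsCoprime ((X - C t) ^ (f.natDegree - 1)) ((X - C u) ^ (f.natDegree - 1)) :=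
      (isCoprime_X_sub_C_of_isUnit_sub (sub_ne_zero.2 hne).isUnit).pow
    have h1 := natDegree_le_of_dvd (hc.mul_dvd (hdvd t ht) (hdvd u hu)) hd0
    rw [natDegree_mul (pow_ne_zero _ (X_sub_C_ne_zero t)) (pow_ne_zero _ (X_sub_C_ne_zero u)),
      natDegree_pow, natDegree_pow, natDegree_X_sub_C, natDegree_X_sub_C] at h1
    have h2 := natDegree_derivative_le f
    omega
  have hfix : ∀ x, (f - X).eval x = 0 → x ∈ preperAux f := by
    intro x hx
    refine ⟨0, 1, by omega, ?_⟩
    have : f.eval x - x = 0 := by simpa using hx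
    simpa using (sub_eq_zero.1 this).symm
  have hdX : (f - X).natDegree = f.natDegree :=
    natDegree_sub_eq_left_of_natDegree_lt (by rw [natDegree_X]; exact hdeg)
  obtain ⟨x, hx⟩ := IsAlgClosed.exists_root (f - X) (by
    intro h0
    have := natDegree_eq_zero_iff_degree_le_zero.2 h0.le
    rw [hdX] at this; omega)
  have hxP := hfix x hx
  have h1 := pow_dvd_derivative_aux (f - X) x (fun y hy => hsub y (hfix y hy) x hxP)
  rw [hdX] at h1
  have h2 := dvd_sub (hdvd x hxP) h1
  have h3 : derivative f - derivative (f - X) = 1 := by simp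
  rw [h3] at h2
  have h4 := natDegree_le_of_dvd h2 one_ne_zero
  rw [natDegree_pow, natDegree_X_sub_C, natDegree_one] at h4
  omega

theorem preperAux_algebraic (f : ℂ[X]) (halg : ∀ i, IsAlgebraic ℚ (f.coeff i))
    (hdeg : 1 < f.natDegree) (x : ℂ) (hx : x ∈ preperAux f) : IsAlgebraic ℚ x := by
  obtain ⟨m, n, hmn, h⟩ := hx
  have hlift : f ∈ lifts (algebraMap (algebraicClosure ℚ ℂ) ℂ) := by
    rw [lifts_iff_coeff_lifts]
    intro i
    exact ⟨⟨f.coeff i, mem_algebraicClosure_iff.2 (halg i)⟩, rfl⟩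
  obtain ⟨p, rfl⟩ := (mem_lifts _).1 hlift
  rw [natDegree_map] at hdeg
  have hfun : (fun y => (p.map (algebraMap (algebraicClosure ℚ ℂ) ℂ)).eval y)
      = fun y => aeval y p := by
    funext y; rw [eval_map_algebraMap]
  rw [hfun] at h
  have hit : ∀ k, (fun y => aeval y p)^[k] x = aeval x (p.comp^[k] X) := by
    intro k
    induction k with
    | zero => simp
    | succ k ih => rw [Function.iterate_succ_apply', ih, Function.iterate_succ_apply', aeval_comp]
  have hK : IsAlgebraic (algebraicClosure ℚ ℂ) x := by
    refine ⟨p.comp^[m] X - p.comp^[n] X, ?_, ?_⟩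
    · intro h0
      have h1 := congrArg natDegree (sub_eq_zero.1 h0)
      rw [natDegree_iterate_comp, natDegree_iterate_comp, natDegree_X, mul_one, mul_one] at h1
      have := Nat.pow_lt_pow_right hdeg hmn
      omega
    · rw [map_sub, ← hit, ← hit, h, sub_self]
  haveI : Algebra.IsAlgebraic ℚ (algebraicClosure ℚ ℂ) := algebraicClosure.isAlgebraic ℚ ℂ
  exact hK.restrictScalars ℚ

theorem algebraic_coeff_of_infinite (g : ℂ[X]) (S : Set ℂ) (hS : S.Infinite)
    (h1 : ∀ x ∈ S, IsAlgebraic ℚ x) (h2 : ∀ x ∈ S, IsAlgebraic ℚ (g.eval x)) :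
    ∀ i, IsAlgebraic ℚ (g.coeff i) := by
  classical
  let K := algebraicClosure ℚ ℂ
  let T : Set K := {x | (x : ℂ) ∈ S}
  have hT : T.Infinite := by
    intro hf
    apply hS
    refine (hf.image (fun x : K => (x : ℂ))).subset ?_
    intro x hx
    exact ⟨⟨x, mem_algebraicClosure_iff.2 (h1 x hx)⟩, hx, rfl⟩
  obtain ⟨s, hsT, hsc⟩ := hT.exists_subset_card_eq (g.natDegree + 1)
  let r : K → K := fun x => if hx : (x : ℂ) ∈ S then
    ⟨g.eval (x : ℂ), mem_algebraicClosure_iff.2 (h2 x hx)⟩ else 0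
  let q : K[X] := Lagrange.interpolate s id r
  have hq : q.degree < s.card := Lagrange.degree_interpolate_lt r (Set.injOn_id _)
  have hgq : g = q.map (algebraMap K ℂ) := by
    have hinj : Function.Injective (algebraMap K ℂ) := (algebraMap K ℂ).injective
    have hc : (s.image (algebraMap K ℂ)).card = s.card := Finset.card_image_of_injective s hinj
    refine eq_of_degrees_lt_of_eval_finset_eq (s.image (algebraMap K ℂ)) ?_ ?_ ?_
    · rw [hc, hsc]
      exact lt_of_le_of_lt degree_le_natDegree (by exact_mod_cast Nat.lt_succ_self _)
    · rw [hc, degree_map]; exact hq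
    · intro x hx
      obtain ⟨y, hy, rfl⟩ := Finset.mem_image.1 hx
      rw [eval_map_apply]
      have : q.eval y = r y := Lagrange.eval_interpolate_at_node r (Set.injOn_id _) hy
      rw [this]
      have hyS : (y : ℂ) ∈ S := hsT hy
      simp only [r, dif_pos hyS]
      rfl
  intro i
  rw [hgq, coeff_map]
  exact mem_algebraicClosure_iff.1 (q.coeff i).2

/-- If `f ∈ ℚ̄[x]` has degree `> 1`, then any polynomial `g ∈ ℂ[x]` commuting with `f` under
composition has all its coefficients algebraic over `ℚ`, i.e. `g ∈ ℚ̄[x]`. -/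
theorem algebraicity_of_commuting_polynomial
    (f : Polynomial ℂ) (halg : ∀ i, IsAlgebraic ℚ (f.coeff i)) (hdeg : 1 < f.natDegree)
    (g : Polynomial ℂ) (hcomm : g.comp f = f.comp g) :
    ∀ i, IsAlgebraic ℚ (g.coeff i) := by
  refine algebraic_coeff_of_infinite g (preperAux f) (preperAux_infinite f hdeg)
    (preperAux_algebraic f halg hdeg) ?_
  rintro x ⟨m, n, hmn, h⟩
  apply preperAux_algebraic f halg hdeg
  refine ⟨m, n, hmn, ?_⟩
  have hsc : Function.Semiconj (fun y => g.eval y) (fun y => f.eval y) (fun y => f.eval y) := by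
    intro y
    have := congrArg (eval y) hcomm
    simpa [eval_comp] using this
  have e : ∀ k, (fun y => f.eval y)^[k] (g.eval x) = g.eval ((fun y => f.eval y)^[k] x) :=
    fun k => ((hsc.iterate_right k) x).symm
  rw [e, e, h]
end

section
/- If f ∈ ℤ̄[x] is a monic polynomial of degree greater than 1 that is not affine conjugate over ℂ to a power function z^d or to plus or minus a Chebyshev polynomial, then any polynomial g ∈ ℂ[x] commuting with f under composition has all of its coefficients in ℤ̄. -/
open Polynomial

noncomputable section

/-- Valuation-theoretic core: if a monic `f` of degree `> 1` has coefficients in a valuation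
subring `A`, so does any polynomial commuting with `f`. -/
theorem coeff_mem_of_comm_s8 (A : ValuationSubring ℂ) (f : Polynomial ℂ) (hmonic : f.Monic)
    (hfdeg : 1 < f.natDegree) (hf : ∀ i, f.coeff i ∈ A)
    (g : Polynomial ℂ) (hcomm : g.comp f = f.comp g) (i : ℕ) : g.coeff i ∈ A := by
  by_contra hi
  have hgi : g.coeff i ≠ 0 := fun h => hi (h ▸ A.zero_mem)
  obtain ⟨j, hj, hmax⟩ := Finset.exists_max_image g.support (fun n => A.valuation (g.coeff n))
    ⟨i, mem_support_iff.2 hgi⟩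
  set c := g.coeff j with hc
  have hc0 : c ≠ 0 := mem_support_iff.1 hj
  have hcA : c ∉ A := by
    intro h
    apply hi
    rw [← A.valuation_le_one_iff] at h ⊢
    exact (hmax i (mem_support_iff.2 hgi)).trans h
  have htm : c⁻¹ ∈ A.nonunits := A.inv_mem_nonunits_iff.2 (Or.inr hcA)
  have htA : c⁻¹ ∈ A := (A.mem_or_inv_mem c).resolve_left hcA
  obtain ⟨F, hF⟩ : ∃ F : Polynomial A, F.map A.subtype = f := by
    rw [← mem_lifts, lifts_iff_coeff_lifts]
    exact fun n => ⟨⟨_, hf n⟩, rfl⟩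
  obtain ⟨h, hh⟩ : ∃ h : Polynomial A, h.map A.subtype = C c⁻¹ * g := by
    rw [← mem_lifts, lifts_iff_coeff_lifts]
    intro n
    refine ⟨⟨c⁻¹ * g.coeff n, ?_⟩, by simp⟩
    by_cases hn : g.coeff n = 0
    · simp [hn]
    · rw [← A.valuation_le_one_iff, map_mul, map_inv₀]
      have h0 : A.valuation c ≠ 0 := (A.valuation.ne_zero_iff).2 hc0
      calc (A.valuation c)⁻¹ * A.valuation (g.coeff n)
          ≤ (A.valuation c)⁻¹ * A.valuation c :=
            mul_le_mul_right (hmax n (mem_support_iff.2 hn)) _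
        _ = 1 := inv_mul_cancel₀ h0
  have hinj : Function.Injective A.subtype := Subtype.val_injective
  have hFm : F.Monic := monic_of_injective hinj (by rw [hF]; exact hmonic)
  have hFd : F.natDegree = f.natDegree := by rw [← hF, natDegree_map_eq_of_injective hinj]
  let t : A := ⟨c⁻¹, htA⟩
  have key : (F.scaleRoots t).comp h = C (t ^ (F.natDegree - 1)) * h.comp F := by
    apply map_injective _ hinj
    have h1 := scaleRoots_eval₂_mul (p := F) ((C : ℂ →+* Polynomial ℂ).comp A.subtype) g t
    have e1 : ((C : ℂ →+* Polynomial ℂ).comp A.subtype) t = C c⁻¹ := rfl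
    rw [e1, ← hh, ← eval₂_map, ← eval₂_map, hF] at h1
    change _ = C c⁻¹ ^ F.natDegree * f.comp g at h1
    rw [map_comp, Polynomial.map_mul, map_comp, hF, map_C, map_pow]
    refine Eq.trans h1 ?_
    rw [← hcomm, hh, mul_comp, C_comp, ← mul_assoc, C_pow]
    change _ = C c⁻¹ ^ (F.natDegree - 1) * C c⁻¹ * _
    rw [← pow_succ, Nat.sub_add_cancel (by omega)]
  have ht : IsLocalRing.residue A t = 0 := by
    rw [IsLocalRing.residue_eq_zero_iff, ← A.coe_mem_nonunits_iff]
    exact htm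
  have key2 := congrArg (Polynomial.map (IsLocalRing.residue A)) key
  rw [map_comp, map_scaleRoots _ _ _ (by simp [hFm.leadingCoeff]), ht, scaleRoots_zero,
    Polynomial.map_mul, map_C, map_pow, ht, zero_pow (by omega), C_0, zero_mul,
    (hFm.map _).leadingCoeff, one_smul, X_pow_comp] at key2
  have hz := pow_eq_zero_iff (by rw [hFm.natDegree_map]; omega) |>.1 key2
  have hhj : h.coeff j = 1 := by
    apply hinj
    rw [← coeff_map, hh, coeff_C_mul, map_one, ← hc, inv_mul_cancel₀ hc0]
  have := congrArg (fun p => p.coeff j) hz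
  simp [hhj] at this

/-- If `f ∈ ℤ̄[x]` is monic of degree `> 1` and not affine conjugate over `ℂ` to a power function
or to plus or minus a Chebyshev polynomial, then any polynomial `g ∈ ℂ[x]` commuting with `f`
under composition has all of its coefficients in `ℤ̄` (the elements of `ℂ` integral over `ℤ`). -/
theorem integrality_of_any_commuting_polynomial
    (f : Polynomial ℂ) (hmonic : f.Monic) (hfdeg : 1 < f.natDegree)
    (hfint : ∀ i, IsIntegral ℤ (f.coeff i))
    (hexc : ¬ IsExceptional f)
    (g : Polynomial ℂ) (hcomm : g.comp f = f.comp g) :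
    ∀ i, IsIntegral ℤ (g.coeff i) := by
  intro i
  by_contra hi
  have hi' : g.coeff i ∉ (integralClosure ℤ ℂ).toSubring := hi
  obtain ⟨V, hV, hiV⟩ := Subring.exists_le_valuationSubring_of_isIntegrallyClosedIn hi'
  exact hiV (coeff_mem_of_comm_s8 V f hmonic hfdeg (fun n => hV (hfint n)) g hcomm i)
end
end
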